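/- There exists a positive constant C such that for every natural number n ≥ 1: |(−log t_n) − 2π²/(3(1 + 2r_n))| ≤ C · e^{−2π√(24n − 1)}. -/

import Mathlib

open Real

/-- `κ₁(t) = ∑_{j≥1} j·t^j/(1−t^j)`. -/
noncomputable def kappa1 (t : ℝ) : ℝ :=
  ∑' j : ℕ, ((j : ℝ) + 1) * t ^ (j + 1) / (1 - t ^ (j + 1))

/-- `r_n = √((2π²/3)(n − 1/24) + 1/4)`. -/
noncomputable def rseq (n : ℕ) : ℝ :=
  Real.sqrt (2 * Real.pi ^ 2 / 3 * ((n : ℝ) - 1 / 24) + 1 / 4)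

lemma G2_eq_kappa1 (z : UpperHalfPlane) (y : ℝ) (hy : 0 < y) (hz : (z : ℂ) = Complex.I * y) :
    EisensteinSeries.G2 z = ((π ^ 2 / 3 - 8 * π ^ 2 * kappa1 (Real.exp (-(2 * π * y))) : ℝ) : ℂ) := by
  have hexp : Complex.exp (2 * π * Complex.I * z) = ((Real.exp (-(2 * π * y)) : ℝ) : ℂ) := by
    rw [hz]
    push_cast
    congr 1
    linear_combination (2 * π * y : ℂ) * Complex.I_sq
  have hlt : Real.exp (-(2 * π * y)) < 1 := by
    rw [Real.exp_lt_one_iff]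
    have := mul_pos (mul_pos two_pos Real.pi_pos) hy
    linarith
  rw [EisensteinSeries.G2_eq_tsum_cexp, hexp, ← tsum_pow_div_one_sub_eq_tsum_sigma
    (by rw [Complex.norm_real, Real.norm_eq_abs, abs_of_pos (Real.exp_pos _)]; exact hlt),
    riemannZeta_two]
  rw [tsum_pnat_eq_tsum_succ (f := fun n : ℕ ↦ (n : ℂ) ^ 1 * ((Real.exp (-(2 * π * y)) : ℝ) : ℂ) ^ n
    / (1 - ((Real.exp (-(2 * π * y)) : ℝ) : ℂ) ^ n))]
  rw [kappa1]
  push_cast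
  simp only [pow_one]
  ring

lemma kappa1_transform (y : ℝ) (hy : 0 < y) :
    kappa1 (Real.exp (-(2 * π * y))) = 1 / 24 - 1 / (4 * π * y) + 1 / (24 * y ^ 2)
      - kappa1 (Real.exp (-(2 * π * (1 / y)))) / y ^ 2 := by
  let z : UpperHalfPlane := ⟨Complex.I * y, by simpa using hy⟩
  have hz : (z : ℂ) = Complex.I * y := rfl
  have hyc : (y : ℂ) ≠ 0 := by exact_mod_cast hy.ne'
  have hS : ((ModularGroup.S • z : UpperHalfPlane) : ℂ) = Complex.I * ((1 / y : ℝ) : ℂ) := by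
    rw [UpperHalfPlane.modular_S_smul]
    change (-(z : ℂ))⁻¹ = _
    rw [hz]
    push_cast
    rw [inv_eq_iff_eq_inv, mul_inv, Complex.inv_I]
    field_simp
  have h := EisensteinSeries.G2_S_transform z
  rw [G2_eq_kappa1 z y hy hz, G2_eq_kappa1 _ (1 / y) (by positivity) hS, hz] at h
  set a := kappa1 (Real.exp (-(2 * π * y)))
  set b := kappa1 (Real.exp (-(2 * π * (1 / y))))
  have h2 : (-2 * π * Complex.I / (Complex.I * y) : ℂ) = ((-2 * π / y : ℝ) : ℂ) := by
    push_cast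
    field_simp
  have h3 : (((Complex.I * y) ^ 2)⁻¹ : ℂ) = ((-(1 / y ^ 2) : ℝ) : ℂ) := by
    rw [mul_pow, Complex.I_sq]
    push_cast
    field_simp
  rw [h2, h3] at h
  have h4 : π ^ 2 / 3 - 8 * π ^ 2 * a =
      -(1 / y ^ 2) * (π ^ 2 / 3 - 8 * π ^ 2 * b) - -2 * π / y := by exact_mod_cast h
  have hpi := Real.pi_pos
  field_simp at h4 ⊢
  linear_combination -4 * h4

lemma kappa1_bound : ∃ K : ℝ, 0 < K ∧ ∀ q : ℝ, 0 < q → q ≤ 1 / 2 →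
    0 ≤ kappa1 q ∧ kappa1 q ≤ K * q := by
  have hs : Summable (fun j : ℕ => 2 * (((j : ℝ) + 1) * (1 / 2) ^ j)) := by
    apply Summable.mul_left
    have h1 := summable_pow_mul_geometric_of_norm_lt_one (R := ℝ) 1 (r := 1 / 2) (by norm_num)
    have h0 := summable_geometric_of_lt_one (r := (1 / 2 : ℝ)) (by norm_num) (by norm_num)
    refine (h1.add h0).congr fun j => ?_
    simp; ring
  have hnn : ∀ j : ℕ, 0 ≤ 2 * (((j : ℝ) + 1) * (1 / 2) ^ j) := fun j => by positivity
  refine ⟨∑' j : ℕ, 2 * (((j : ℝ) + 1) * (1 / 2) ^ j), ?_, ?_⟩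
  · exact hs.tsum_pos hnn 0 (by norm_num)
  intro q hq hq2
  have hp : ∀ j : ℕ, q ^ (j + 1) ≤ 1 / 2 := fun j => by
    rw [pow_succ]
    have : q ^ j ≤ 1 := pow_le_one₀ hq.le (by linarith)
    nlinarith
  have hterm0 : ∀ j : ℕ, 0 ≤ ((j : ℝ) + 1) * q ^ (j + 1) / (1 - q ^ (j + 1)) := fun j => by
    have := hp j
    apply div_nonneg (by positivity) (by linarith)
  have hterm : ∀ j : ℕ, ((j : ℝ) + 1) * q ^ (j + 1) / (1 - q ^ (j + 1)) ≤
      2 * (((j : ℝ) + 1) * (1 / 2) ^ j) * q := fun j => by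
    have h1 := hp j
    have h2 : q ^ j ≤ (1 / 2) ^ j := pow_le_pow_left₀ hq.le hq2 j
    rw [div_le_iff₀ (by linarith)]
    have h3 : ((j : ℝ) + 1) * q ^ (j + 1) ≤ ((j : ℝ) + 1) * (1 / 2) ^ j * q := by
      rw [pow_succ, ← mul_assoc]
      gcongr
    have h4 : 0 ≤ ((j : ℝ) + 1) * (1 / 2) ^ j * q := by positivity
    nlinarith
  refine ⟨tsum_nonneg hterm0, ?_⟩
  rw [← tsum_mul_right]
  exact Summable.tsum_le_tsum hterm
    (Summable.of_nonneg_of_le hterm0 hterm (hs.mul_right q)) (hs.mul_right q)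

lemma kappa1_nonneg (q : ℝ) (hq : 0 < q) (hq1 : q < 1) : 0 ≤ kappa1 q := by
  apply tsum_nonneg
  intro j
  have : q ^ (j + 1) ≤ 1 := pow_le_one₀ hq.le hq1.le
  apply div_nonneg (by positivity) (by linarith)

/-- `|(−log t_n) − 2π²/(3(1+2r_n))| ≤ C·e^{−2π√(24n−1)}`. -/
theorem stmt11 :
    ∃ C : ℝ, 0 < C ∧ ∀ n : ℕ, 1 ≤ n → ∀ t : ℝ, t ∈ Set.Ioo (0 : ℝ) 1 → kappa1 t = n →
      |(-Real.log t) - 2 * Real.pi ^ 2 / (3 * (1 + 2 * rseq n))| ≤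
        C * Real.exp (-(2 * Real.pi) * Real.sqrt (24 * (n : ℝ) - 1)) := by
  obtain ⟨K, hK, hbound⟩ := kappa1_bound
  have hpi := Real.pi_pos
  have hpi3 := Real.pi_gt_three
  refine ⟨16 * π ^ 2 * K, by positivity, ?_⟩
  intro n hn t ht hkt
  have hn' : (1 : ℝ) ≤ n := by exact_mod_cast hn
  set s := Real.sqrt (24 * (n : ℝ) - 1) with hs
  have hs2 : s ^ 2 = 24 * (n : ℝ) - 1 := Real.sq_sqrt (by linarith)
  have hs0 : 0 ≤ s := Real.sqrt_nonneg _
  set r := rseq n with hr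
  have hr0 : 0 ≤ r := Real.sqrt_nonneg _
  have hr2 : r ^ 2 = π ^ 2 / 36 * s ^ 2 + 1 / 4 := by
    rw [hr, rseq, Real.sq_sqrt, hs2]
    · ring
    · have : 0 ≤ (n : ℝ) - 1 / 24 := by linarith
      positivity
  have hrs : π / 6 * s ≤ r := by
    refine abs_le_of_sq_le_sq' ?_ hr0 |>.2
    nlinarith
  have hr1 : 1 ≤ r := by
    nlinarith
  -- x and u
  set x := -Real.log t with hx
  have hx0 : 0 < x := by have := Real.log_neg ht.1 ht.2; linarith
  obtain ⟨u, hu0, hxu⟩ : ∃ u : ℝ, 0 < u ∧ x = 1 / u := ⟨1 / x, by positivity, by simp⟩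
  have htr := kappa1_transform (1 / (2 * π * u)) (by positivity)
  have e1 : Real.exp (-(2 * π * (1 / (2 * π * u)))) = t := by
    have : -(2 * π * (1 / (2 * π * u))) = Real.log t := by
      have : Real.log t = -x := by rw [hx]; ring
      rw [this, hxu]
      field_simp
    rw [this, Real.exp_log ht.1]
  have e2 : -(2 * π * (1 / (1 / (2 * π * u)))) = -(4 * π ^ 2 * u) := by
    field_simp; ring
  rw [e1, e2, hkt] at htr
  set k := kappa1 (Real.exp (-(4 * π ^ 2 * u))) with hk
  have hmain : (n : ℝ) = 1 / 24 - u / 2 + π ^ 2 * u ^ 2 / 6 - 4 * π ^ 2 * u ^ 2 * k := by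
    rw [htr]; field_simp; ring
  have hk0 : 0 ≤ k := by
    apply kappa1_nonneg _ (Real.exp_pos _)
    rw [Real.exp_lt_one_iff]
    have : 0 < 4 * π ^ 2 * u := by positivity
    linarith
  obtain ⟨v, hv⟩ : ∃ v : ℝ, v = 3 * (1 + 2 * r) / (2 * π ^ 2) := ⟨_, rfl⟩
  have hv0 : 0 < v := by rw [hv]; positivity
  have hv1 : 2 * π ^ 2 / (3 * (1 + 2 * r)) = 1 / v := by rw [hv]; field_simp
  have hv2 : π ^ 2 * v = 3 / 2 + 3 * r := by rw [hv]; field_simp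
  have hv3 : 1 / v ≤ 2 * π ^ 2 / 3 := by
    rw [← hv1]
    apply div_le_div_of_nonneg_left (by positivity) (by norm_num) (by linarith)
  have hfac : (u - v) * (π ^ 2 * u / 6 + r / 2 - 1 / 4) = 4 * π ^ 2 * u ^ 2 * k := by
    have hvq : π ^ 2 * v ^ 2 / 6 - v / 2 = n - 1 / 24 := by
      have h1 : π ^ 2 * (π ^ 2 * v ^ 2 / 6 - v / 2) = π ^ 2 * (n - 1 / 24) := by
        have : π ^ 2 * (π ^ 2 * v ^ 2 / 6 - v / 2) = (π ^ 2 * v) ^ 2 / 6 - (π ^ 2 * v) / 2 := by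
          ring
        rw [this, hv2]
        linear_combination (3 / 2) * hr2 + π ^ 2 / 24 * hs2
      exact mul_left_cancel₀ (by positivity) h1
    linear_combination (-(u - v) / 6) * hv2 - hmain - hvq
  have hD : π ^ 2 * u / 6 ≤ π ^ 2 * u / 6 + r / 2 - 1 / 4 := by linarith
  have hD0 : 0 < π ^ 2 * u / 6 := by positivity
  have huv : 0 ≤ u - v := by
    have : 0 ≤ (u - v) * (π ^ 2 * u / 6 + r / 2 - 1 / 4) := by rw [hfac]; positivity
    exact nonneg_of_mul_nonneg_left this (by linarith)
  have huv2 : u - v ≤ 24 * u * k := by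
    have h1 : (u - v) * (π ^ 2 * u / 6) ≤ 4 * π ^ 2 * u ^ 2 * k := by
      rw [← hfac]; exact mul_le_mul_of_nonneg_left hD huv
    have h2 : 4 * π ^ 2 * u ^ 2 * k = (24 * u * k) * (π ^ 2 * u / 6) := by ring
    rw [h2] at h1
    exact le_of_mul_le_mul_right h1 hD0
  have hq : Real.exp (-(4 * π ^ 2 * u)) ≤ Real.exp (-6 - 12 * r) := by
    apply Real.exp_le_exp.mpr
    have : π ^ 2 * v ≤ π ^ 2 * u := mul_le_mul_of_nonneg_left (by linarith) (by positivity)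
    linarith
  have hq1 : Real.exp (-(4 * π ^ 2 * u)) ≤ 1 / 2 := by
    have h1 : Real.exp (-6 - 12 * r) ≤ Real.exp (-1) := Real.exp_le_exp.mpr (by linarith)
    have h2 : Real.exp (-1) ≤ 1 / 2 := by
      rw [Real.exp_neg, ← one_div]
      apply div_le_div_of_nonneg_left (by norm_num) (by norm_num)
      have := Real.add_one_le_exp 1
      linarith
    linarith
  have hq2 : Real.exp (-(4 * π ^ 2 * u)) ≤ Real.exp (-(2 * π) * s) := by
    refine hq.trans (Real.exp_le_exp.mpr ?_)
    linarith
  have hkK := (hbound _ (Real.exp_pos _) hq1).2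
  rw [← hk] at hkK
  rw [hv1, hxu, abs_sub_comm]
  have hdiff : 1 / v - 1 / u = (u - v) / u * (1 / v) := by field_simp
  have h5 : (u - v) / u ≤ 24 * k := by
    rw [div_le_iff₀ hu0]; linarith
  have h6 : 0 ≤ (u - v) / u := div_nonneg huv hu0.le
  have h7 : 0 ≤ 1 / v := by positivity
  rw [hdiff, abs_of_nonneg (mul_nonneg h6 h7)]
  calc (u - v) / u * (1 / v) ≤ (24 * k) * (2 * π ^ 2 / 3) :=
        mul_le_mul h5 hv3 h7 (by positivity)
    _ = 16 * π ^ 2 * k := by ring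
    _ ≤ 16 * π ^ 2 * (K * Real.exp (-(2 * π) * s)) := by
        apply mul_le_mul_of_nonneg_left _ (by positivity)
        exact hkK.trans (mul_le_mul_of_nonneg_left hq2 hK.le)
    _ = 16 * π ^ 2 * K * Real.exp (-(2 * π) * s) := by ring
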